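/- Let R and R′ be two rings of butterflies, each with 7 links, such that V(R) ∩ V(R′) = {x,y} where {x,y} is a hinge of both R and R′ (hence a nonedge of both), and E(R) ∩ E(R′) = ∅. Then the union R ∪ R′ (with vertex set V(R) ∪ V(R′) and edge set E(R) ∪ E(R′)) is dependent and nucleation-free. -/

import Mathlib

noncomputable section

open scoped RealInnerProductSpace

namespace Rigidity

variable {V : Type*}

/-- The row of the rigidity matrix of the framework `p` corresponding to the
ordered pair `(x, y)`: it has `p x - p y` in the three columns of `x`,
`p y - p x` in the three columns of `y`, and `0` elsewhere. -/
def rigidityRow [DecidableEq V] (p : V → Fin 3 → ℝ) (x y : V) : V × Fin 3 → ℝ :=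
  fun vi =>
    (if vi.1 = x then p x vi.2 - p y vi.2 else 0) +
    (if vi.1 = y then p y vi.2 - p x vi.2 else 0)

/-- The rank of the rigidity matrix of the framework `(G, p)`, i.e. the dimension of
the span of its rows (one row for each edge of `G`). -/
def rigidityRank [DecidableEq V] (G : SimpleGraph V) (p : V → Fin 3 → ℝ) : ℕ :=
  Module.finrank ℝ
    (Submodule.span ℝ {w : V × Fin 3 → ℝ | ∃ x y, G.Adj x y ∧ w = rigidityRow p x y})

/-- The generic 3-dimensional rank `rank₃ G`: the maximum, over all frameworks `p`,
of the rank of the rigidity matrix `R(G, p)`. -/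
def genRank [DecidableEq V] (G : SimpleGraph V) : ℕ :=
  sSup {n : ℕ | ∃ p : V → Fin 3 → ℝ, n = rigidityRank G p}

/-- `G` is independent in the generic 3-dimensional rigidity matroid. -/
def IsIndependent [DecidableEq V] (G : SimpleGraph V) : Prop :=
  genRank G = G.edgeSet.ncard

/-- `G` is (generically) rigid in dimension 3: `rank₃ G = 3|V| - 6`. -/
def IsRigid [DecidableEq V] (G : SimpleGraph V) : Prop :=
  genRank G = 3 * Nat.card V - 6

/-- `G` is nucleation-free: it has no rigid subgraph on at least 5 vertices. -/
def NucleationFree [DecidableEq V] (G : SimpleGraph V) : Prop :=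
  ∀ H : G.Subgraph, 5 ≤ H.verts.ncard → ¬ IsRigid H.coe

/-- The graph `G + {x,y}` obtained from `G` by adding the edge `{x, y}`. -/
def addEdge (G : SimpleGraph V) (x y : V) : SimpleGraph V :=
  G ⊔ SimpleGraph.fromEdgeSet {s(x, y)}

/-- `{x, y}` is an implied nonedge of `G`: it is a nonedge and adding it
does not change the generic 3-dimensional rank. -/
def ImpliedNonedge [DecidableEq V] (G : SimpleGraph V) (x y : V) : Prop :=
  x ≠ y ∧ ¬ G.Adj x y ∧ genRank (addEdge G x y) = genRank G

/-- `G` is a circuit of the generic 3-dimensional rigidity matroid: it is dependent and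
deleting any one edge yields an independent graph. -/
def IsCircuit [DecidableEq V] (G : SimpleGraph V) : Prop :=
  ¬ IsIndependent G ∧ ∀ e ∈ G.edgeSet, IsIndependent (G.deleteEdges {e})

/-- The vertex set `W` is contained in some `K₄` subgraph of `G`. -/
def ContainedInK4 (G : SimpleGraph V) (W : Set V) : Prop :=
  ∃ s : Set V, W ⊆ s ∧ s.ncard = 4 ∧ G.IsClique s

/-- The canonical ring of `m` butterflies: vertices `(i, 0) = aᵢ`, `(i, 1) = bᵢ` and
`(i, 2) = eᵢ`; link `i` is the complete graph on `aᵢ, bᵢ, eᵢ, aᵢ₊₁, bᵢ₊₁` minus the two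
hinge pairs `{aᵢ, bᵢ}` and `{aᵢ₊₁, bᵢ₊₁}` (a butterfly). -/
def butterflyRing (m : ℕ) : SimpleGraph (ZMod m × Fin 3) :=
  SimpleGraph.fromRel fun x y =>
    (x.1 = y.1 ∧ x ≠ y ∧ (x.2 = 2 ∨ y.2 = 2)) ∨ (y.1 = x.1 + 1 ∧ y.2 ≠ 2)

/-- `G` is a ring of `m` butterflies with hinges `{a i, b i}`. -/
def IsRingOfButterflies (m : ℕ) (G : SimpleGraph V) (a b : ZMod m → V) : Prop :=
  ∃ φ : G ≃g butterflyRing m, (∀ i, φ (a i) = (i, 0)) ∧ (∀ i, φ (b i) = (i, 1))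

/-- `G` is a ring of `m` butterflies with vertex set `S`, vertex labelling `f`
(all vertices of `V` outside `S` being isolated in `G`). -/
def IsRingOfButterfliesOn (m : ℕ) (G : SimpleGraph V) (S : Set V)
    (f : ZMod m × Fin 3 → V) : Prop :=
  Function.Injective f ∧ Set.range f = S ∧ G.support ⊆ S ∧
    ∀ x y, G.Adj (f x) (f y) ↔ (butterflyRing m).Adj x y

/-- `R` is a ring with links `L i` (subgraphs of `R`) and hinges `{a i, b i}`:
the links cover `R`, the `2m` hinge vertices are pairwise distinct, link `i` contains the
hinge vertices `a i, b i, a (i+1), b (i+1)`, and two distinct links share only hinge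
vertices common to both of them. -/
def IsRingDecomp (m : ℕ) (R : SimpleGraph V) (L : ZMod m → R.Subgraph)
    (a b : ZMod m → V) : Prop :=
  (⨆ i, (L i).spanningCoe) = R ∧
  Function.Injective (fun x : ZMod m × Bool => if x.2 then a x.1 else b x.1) ∧
  (∀ i, a i ∈ (L i).verts ∧ b i ∈ (L i).verts ∧
    a (i + 1) ∈ (L i).verts ∧ b (i + 1) ∈ (L i).verts) ∧
  (∀ i j, i ≠ j →
    (L i).verts ∩ (L j).verts ⊆
      ({a i, b i, a (i + 1), b (i + 1)} : Set V) ∩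
        ({a j, b j, a (j + 1), b (j + 1)} : Set V))

/-- The shared set `S(𝒳)` of a cover: all pairs `{x, y}` of distinct vertices such that
`{x, y} = X ∩ Y` for two distinct clusters `X, Y` of `𝒳`. -/
def sharedSet (𝒳 : Finset (Set V)) : Set (Sym2 V) :=
  {e | ∃ x y : V, x ≠ y ∧ e = s(x, y) ∧ ∃ X ∈ 𝒳, ∃ Y ∈ 𝒳, X ≠ Y ∧ X ∩ Y = {x, y}}

/-- `d(𝒳, e)`: the number of clusters of `𝒳` containing both endpoints of `e`. -/
def coverDeg (𝒳 : Finset (Set V)) (e : Sym2 V) : ℕ :=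
  {X : Set V | X ∈ 𝒳 ∧ ∀ v ∈ e, v ∈ X}.ncard

/-- `𝒳` is a 2-thin cover of `G`. -/
def IsTwoThinCover (G : SimpleGraph V) (𝒳 : Finset (Set V)) : Prop :=
  (∀ X ∈ 𝒳, 2 ≤ X.ncard) ∧
  (∀ X ∈ 𝒳, ∀ Y ∈ 𝒳, X ≠ Y → (X ∩ Y).ncard ≤ 2 ∧ ¬ X ⊂ Y) ∧
  (∀ x y : V, G.Adj x y → ∃ X ∈ 𝒳, x ∈ X ∧ y ∈ X)

/-- `Gs` is a nonedge-split of `G` at the nonedge `{a, b}` with new vertices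
`a₁, a₂, b₁, b₂`: the neighborhoods of `a₁, a₂` partition the neighborhood of `a`, the
neighborhoods of `b₁, b₂` partition the neighborhood of `b`, and `a`, `b` are deleted
(i.e. become isolated). -/
def IsNonedgeSplit (G Gs : SimpleGraph V) (a b a₁ a₂ b₁ b₂ : V) : Prop :=
  ¬ G.Adj a b ∧
  ([a, b, a₁, a₂, b₁, b₂] : List V).Pairwise (· ≠ ·) ∧
  a₁ ∉ G.support ∧ a₂ ∉ G.support ∧ b₁ ∉ G.support ∧ b₂ ∉ G.support ∧
  ∃ A ⊆ G.neighborSet a, ∃ B ⊆ G.neighborSet b,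
    Gs = (G.deleteEdges {e | a ∈ e ∨ b ∈ e}) ⊔
      SimpleGraph.fromEdgeSet
        (((fun w => s(a₁, w)) '' A) ∪ ((fun w => s(a₂, w)) '' (G.neighborSet a \ A)) ∪
         ((fun w => s(b₁, w)) '' B) ∪ ((fun w => s(b₂, w)) '' (G.neighborSet b \ B)))

/-- The double-butterfly on the eight vertices `a₁, a₂, b₁, b₂, u, v, c, c'`. -/
def doubleButterfly (a₁ a₂ b₁ b₂ u v c c' : V) : SimpleGraph V :=
  SimpleGraph.fromEdgeSet
    {s(a₁, u), s(a₁, v), s(a₂, u), s(a₂, v), s(b₁, u), s(b₁, v), s(b₂, u), s(b₂, v),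
     s(c, a₁), s(c, b₁), s(c, u), s(c, v), s(c', a₂), s(c', b₂), s(c', u), s(c', v)}

/-- `G'` is obtained from `G` by a double-butterfly split-and-glue at the nonedge
`{a, b}`: a nonedge-split of `G` at `{a, b}` with new vertices `a₁, a₂, b₁, b₂`, followed by
gluing a double-butterfly (with fresh vertices `u, v, c, c'`) along `a₁, a₂, b₁, b₂`. -/
def IsDoubleButterflySG (G G' : SimpleGraph V)
    (a b a₁ a₂ b₁ b₂ u v c c' : V) : Prop :=
  ∃ Gs : SimpleGraph V, IsNonedgeSplit G Gs a b a₁ a₂ b₁ b₂ ∧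
    ([a, b, a₁, a₂, b₁, b₂, u, v, c, c'] : List V).Pairwise (· ≠ ·) ∧
    u ∉ G.support ∧ v ∉ G.support ∧ c ∉ G.support ∧ c' ∉ G.support ∧
    G' = Gs ⊔ doubleButterfly a₁ a₂ b₁ b₂ u v c c'

/-- `s` is an equilibrium self-stress of the framework `(G, p)`. -/
def IsSelfStress [Fintype V] (G : SimpleGraph V) [DecidableRel G.Adj]
    (p : V → EuclideanSpace ℝ (Fin 3)) (s : Sym2 V → ℝ) : Prop :=
  ∀ x : V, (∑ y : V, if G.Adj x y then s s(x, y) • (p x - p y) else 0) = 0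

/-- `K(U)`: the edge set of the complete graph on the vertex set `U`. -/
def completeOn (U : Set V) : Set (Sym2 V) :=
  {e | ¬ e.IsDiag ∧ ∀ v ∈ e, v ∈ U}

/-- `V(E)`: the set of endpoints of the pairs in `E`. -/
def vertexSet (E : Set (Sym2 V)) : Set V := {v | ∃ e ∈ E, v ∈ e}

/-- `M` is an abstract `d`-rigidity matroid (axioms C1 and C2). -/
def IsAbstractRigidityMatroid (d : ℕ) (M : Matroid (Sym2 V)) : Prop :=
  (∀ E₁ E₂ : Set (Sym2 V), E₁ ⊆ M.E → E₂ ⊆ M.E →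
     (vertexSet E₁ ∩ vertexSet E₂).ncard ≤ d - 1 →
     M.closure (E₁ ∪ E₂) ⊆ completeOn (vertexSet E₁) ∪ completeOn (vertexSet E₂)) ∧
  (∀ E₁ E₂ : Set (Sym2 V), E₁ ⊆ M.E → E₂ ⊆ M.E →
     d ≤ (vertexSet E₁ ∩ vertexSet E₂).ncard →
     M.closure E₁ = completeOn (vertexSet E₁) →
     M.closure E₂ = completeOn (vertexSet E₂) →
     M.closure (E₁ ∪ E₂) = completeOn (vertexSet E₁ ∪ vertexSet E₂))

/-- The five vertices of link `i` of the canonical ring of seven butterflies. -/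
def linkVertex (i : ZMod 7) : Fin 5 → ZMod 7 × Fin 3 :=
  ![(i, 0), (i, 1), (i, 2), (i + 1, 0), (i + 1, 1)]

/-- The eight edges of a butterfly, as pairs of positions in a link. -/
def butterflyEdge : Fin 8 → Fin 5 × Fin 5 :=
  ![(0, 2), (1, 2), (2, 3), (2, 4), (0, 3), (0, 4), (1, 3), (1, 4)]

/-- The enumeration of the edges of the canonical ring of seven butterflies. -/
def ringEdge (e : ZMod 7 × Fin 8) : Sym2 (ZMod 7 × Fin 3) :=
  s(linkVertex e.1 (butterflyEdge e.2).1, linkVertex e.1 (butterflyEdge e.2).2)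

theorem ringEdge_injective : Function.Injective ringEdge := by
  unfold Function.Injective
  decide +kernel

theorem range_ringEdge : Set.range ringEdge = (butterflyRing 7).edgeSet := by
  have key : ∀ x y : ZMod 7 × Fin 3,
      (∃ e, ringEdge e = s(x, y)) ↔ (x ≠ y ∧
        (((x.1 = y.1 ∧ x ≠ y ∧ (x.2 = 2 ∨ y.2 = 2)) ∨ (y.1 = x.1 + 1 ∧ y.2 ≠ 2 )) ∨
        ((y.1 = x.1 ∧ y ≠ x ∧ (y.2 = 2 ∨ x.2 = 2)) ∨ (x.1 = y.1 + 1 ∧ x.2 ≠ 2)))) := by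
    decide +kernel
  ext e
  induction e with
  | _ x y =>
    rw [Set.mem_range, key, SimpleGraph.mem_edgeSet, butterflyRing, SimpleGraph.fromRel_adj]

/-- The lower bounds on `C = 3 * N - (number of edges)` for a set of `N` vertices of a ring of
butterflies; `h` says that the set contains both vertices of some hinge. -/
def SparseBound (N C : ℤ) (h : Prop) : Prop :=
  0 ≤ N ∧ 0 ≤ C ∧ (1 ≤ N → 3 ≤ C) ∧ (2 ≤ N → 5 ≤ C) ∧ (3 ≤ N → 6 ≤ C) ∧ (4 ≤ N → 7 ≤ C) ∧
    (h → 2 ≤ N ∧ 6 ≤ C ∧ (3 ≤ N → 7 ≤ C))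

theorem SparseBound.step {N C x x' z : ℤ} {h : Prop} (H : SparseBound N C h) (hxN : x ≤ N)
    (hx2 : x = 2 → h) (hx : 0 ≤ x ∧ x ≤ 2) (hx' : 0 ≤ x' ∧ x' ≤ 2) (hz : 0 ≤ z ∧ z ≤ 1) :
    SparseBound (N + (z + x')) (C + (3 * x' - x * x' + z * (3 - x - x'))) (h ∨ x' = 2) := by
  obtain ⟨hx0, hx1⟩ := hx
  obtain ⟨hx'0, hx'1⟩ := hx'
  obtain ⟨hz0, hz1⟩ := hz
  unfold SparseBound at *
  by_cases hh : h <;> simp only [hh, true_or, false_or, true_imp_iff, false_imp_iff, imp_false,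
      and_true] at H hx2 ⊢ <;>
    interval_cases x <;> interval_cases x' <;> interval_cases z <;>
    omega

/-- A path of links, starting from an empty hinge, satisfies the sparsity bounds. -/
theorem sparseBound_path (x z : ℕ → ℤ) (hx : ∀ k, 0 ≤ x k ∧ x k ≤ 2)
    (hz : ∀ k, 0 ≤ z k ∧ z k ≤ 1) (h0 : x 0 = 0) (n : ℕ) :
    SparseBound (∑ k ∈ Finset.range n, (z k + x (k + 1)))
      (∑ k ∈ Finset.range n,
        (3 * x (k + 1) - x k * x (k + 1) + z k * (3 - x k - x (k + 1))))
      (∃ k < n, x (k + 1) = 2) ∧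
    x n ≤ ∑ k ∈ Finset.range n, (z k + x (k + 1)) ∧ (x n = 2 → ∃ k < n, x (k + 1) = 2) := by
  induction n with
  | zero => simp [SparseBound, h0]
  | succ n ih =>
    obtain ⟨ih, hN, h2⟩ := ih
    refine ⟨?_, ?_, fun h => ⟨n, n.lt_succ_self, h⟩⟩
    · rw [Finset.sum_range_succ, Finset.sum_range_succ]
      convert ih.step hN h2 (hx n) (hx (n + 1)) (hz n) using 1
      constructor
      · rintro ⟨k, hk, hk2⟩
        rcases Nat.lt_succ_iff_lt_or_eq.mp hk with hk | rfl
        · exact Or.inl ⟨k, hk, hk2⟩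
        · exact Or.inr hk2
      · rintro (⟨k, hk, hk2⟩ | hk2)
        · exact ⟨k, hk.trans n.lt_succ_self, hk2⟩
        · exact ⟨n, n.lt_succ_self, hk2⟩
    · rw [Finset.sum_range_succ]
      linarith [hx n, hx (n + 1), hz n]

theorem sum_zmod_seven_eq_sum_range (F : ZMod 7 → ℤ) (i : ZMod 7) :
    ∑ j, F j = ∑ k ∈ Finset.range 7, F (i + (k : ℕ)) := by
  rw [← Equiv.sum_comp (Equiv.addLeft i) F, Finset.sum_range]
  rfl

/-- The sparsity bounds for a cycle of seven links, in terms of the number `x i` of vertices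
chosen in hinge `i` and the number `z i` of other vertices chosen in link `i`. -/
theorem sparseBound_cycle (x z : ZMod 7 → ℤ) (hx : ∀ k, 0 ≤ x k ∧ x k ≤ 2)
    (hz : ∀ k, 0 ≤ z k ∧ z k ≤ 1) :
    SparseBound (∑ i, (x i + z i))
      (∑ i, (3 * (x i + z i) - (x i * x (i + 1) + z i * (x i + x (i + 1))))) (∃ i, x i = 2) := by
  have shift : ∑ i, x (i + 1) = ∑ i, x i := Equiv.sum_comp (Equiv.addRight (1 : ZMod 7)) x
  by_cases h : ∃ i, x i = 0
  · obtain ⟨i, hi⟩ := h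
    have H := (sparseBound_path (fun k => x (i + k)) (fun k => z (i + k)) (fun k => hx _)
      (fun k => hz _) (by simpa using hi) 7).1
    have e1 : ∑ i, (x i + z i) = ∑ k ∈ Finset.range 7, (z (i + k) + x (i + (k + 1 : ℕ))) := by
      have := sum_zmod_seven_eq_sum_range (fun j => z j + x (j + 1)) i
      simp only [add_assoc, Finset.sum_add_distrib, shift] at this
      simp only [Nat.cast_add, Nat.cast_one, Finset.sum_add_distrib]
      linarith
    have e2 : ∑ i, (3 * (x i + z i) - (x i * x (i + 1) + z i * (x i + x (i + 1)))) =
        ∑ k ∈ Finset.range 7, (3 * x (i + (k + 1 : ℕ)) - x (i + k) * x (i + (k + 1 : ℕ)) +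
          z (i + k) * (3 - x (i + k) - x (i + (k + 1 : ℕ)))) := by
      have := sum_zmod_seven_eq_sum_range
        (fun j => 3 * x (j + 1) - x j * x (j + 1) + z j * (3 - x j - x (j + 1))) i
      simp only [Nat.cast_add, Nat.cast_one, ← add_assoc]
      rw [← this]
      simp only [Finset.sum_sub_distrib, Finset.sum_add_distrib, mul_add, mul_sub,
        ← Finset.mul_sum, ← Finset.sum_mul, shift]
      ring
    rw [e1, e2]
    convert H using 1
    constructor
    · rintro ⟨j, hj⟩
      refine ⟨(j - i - 1).val, (j - i - 1).val_lt, ?_⟩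
      push_cast
      rw [ZMod.natCast_zmod_val]
      simpa using hj
    · rintro ⟨k, -, hk⟩
      exact ⟨_, hk⟩
  · push Not at h
    have hN : (0 : ℤ) ≤ ∑ i, (x i + z i) :=
      Finset.sum_nonneg fun i _ => add_nonneg (hx i).1 (hz i).1
    have hC : (7 : ℤ) ≤
        ∑ i, (3 * (x i + z i) - (x i * x (i + 1) + z i * (x i + x (i + 1)))) := by
      have h1 : ∑ i : ZMod 7, (2 : ℤ) ≤
          ∑ i, (3 * (x i + x (i + 1)) - 2 * (x i * x (i + 1)) +
            2 * (z i * (3 - (x i + x (i + 1))))) := by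
        refine Finset.sum_le_sum fun i _ => ?_
        have a1 := hx i
        have a2 := hx (i + 1)
        have a3 := hz i
        have a4 := h i
        have a5 := h (i + 1)
        generalize x i = u at *
        generalize x (i + 1) = v at *
        generalize z i = w at *
        obtain ⟨a10, a11⟩ := a1
        obtain ⟨a20, a21⟩ := a2
        obtain ⟨a30, a31⟩ := a3
        interval_cases u <;> interval_cases v <;> interval_cases w <;> simp_all
      have h2 : ∑ i, (3 * (x i + x (i + 1)) - 2 * (x i * x (i + 1)) +
            2 * (z i * (3 - (x i + x (i + 1))))) =
          2 * ∑ i, (3 * (x i + z i) - (x i * x (i + 1) + z i * (x i + x (i + 1)))) := by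
        simp only [Finset.sum_sub_distrib, Finset.sum_add_distrib, mul_add, mul_sub,
          ← Finset.mul_sum, ← Finset.sum_mul, shift]
        ring
      rw [h2] at h1
      simp only [Finset.sum_const, Finset.card_univ, ZMod.card, nsmul_eq_mul, Nat.cast_ofNat] at h1
      omega
    refine ⟨hN, by omega, fun _ => by omega, fun _ => by omega, fun _ => by omega,
      fun _ => hC, ?_⟩
    rintro ⟨i, hi⟩
    refine ⟨?_, by omega, fun _ => hC⟩
    calc (2 : ℤ) ≤ x i + z i := by linarith [hz i]
      _ ≤ _ := Finset.single_le_sum (f := fun i => x i + z i)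
        (fun j _ => add_nonneg (hx j).1 (hz j).1) (Finset.mem_univ i)

/-- The sparsity bounds for a set of vertices of the ring of seven butterflies. -/
theorem sparseBound_ring (A : Finset (ZMod 7 × Fin 3)) :
    SparseBound A.card
      (3 * A.card - (Finset.univ.filter fun e => ∀ v ∈ ringEdge e, v ∈ A).card)
      (∃ i, (i, 0) ∈ A ∧ (i, 1) ∈ A) := by
  let c : ZMod 7 × Fin 3 → ℤ := fun v => if v ∈ A then 1 else 0
  have hc : ∀ v, 0 ≤ c v ∧ c v ≤ 1 := fun v => by
    by_cases h : v ∈ A <;> simp [c, h]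
  have H := sparseBound_cycle (fun i => c (i, 0) + c (i, 1)) (fun i => c (i, 2))
    (fun i => ⟨add_nonneg (hc _).1 (hc _).1, by linarith [hc (i, 0), hc (i, 1)]⟩) (fun i => hc _)
  have hA : (A.card : ℤ) = ∑ i, (c (i, 0) + c (i, 1) + c (i, 2)) := by
    have : (A.card : ℤ) = ∑ v, c v := by simp [c]
    rw [this, Fintype.sum_prod_type]
    simp [Fin.sum_univ_succ, add_assoc]
  have hE : ((Finset.univ.filter fun e => ∀ v ∈ ringEdge e, v ∈ A).card : ℤ) =
      ∑ i, ((c (i, 0) + c (i, 1)) * (c (i + 1, 0) + c (i + 1, 1)) +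
        c (i, 2) * ((c (i, 0) + c (i, 1)) + (c (i + 1, 0) + c (i + 1, 1)))) := by
    have h1 : ((Finset.univ.filter fun e => ∀ v ∈ ringEdge e, v ∈ A).card : ℤ) =
        ∑ e : ZMod 7 × Fin 8, c (linkVertex e.1 (butterflyEdge e.2).1) *
          c (linkVertex e.1 (butterflyEdge e.2).2) := by
      rw [Finset.card_filter]
      push_cast
      refine Finset.sum_congr rfl fun e _ => ?_
      simp only [ringEdge, Sym2.mem_iff, forall_eq_or_imp, forall_eq, c, ite_and, mul_ite, mul_one,
        mul_zero]
      split_ifs <;> rfl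
    rw [h1, Fintype.sum_prod_type]
    refine Finset.sum_congr rfl fun i _ => ?_
    simp [Fin.sum_univ_succ, butterflyEdge, linkVertex]
    ring
  convert H using 1
  · rw [hA, hE, Finset.mul_sum, ← Finset.sum_sub_distrib]
  · refine exists_congr fun i => ?_
    by_cases h0 : (i, (0 : Fin 3)) ∈ A <;> by_cases h1 : (i, (1 : Fin 3)) ∈ A <;> simp [c, h0, h1]

theorem IsRingOfButterfliesOn.edgeSet_eq {R : SimpleGraph V} {S : Set V}
    {f : ZMod 7 × Fin 3 → V} (hR : IsRingOfButterfliesOn 7 R S f) :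
    R.edgeSet = Set.range fun e => (ringEdge e).map f := by
  obtain ⟨hf, hS, hsupp, hadj⟩ := hR
  have hcomp : (Set.range fun e => (ringEdge e).map f) =
      Sym2.map f '' (butterflyRing 7).edgeSet := by
    rw [← range_ringEdge, ← Set.range_comp]
    rfl
  rw [hcomp]
  ext e
  induction e with
  | _ u v =>
    constructor
    · intro h
      rw [SimpleGraph.mem_edgeSet] at h
      obtain ⟨u, rfl⟩ := hS.ge (hsupp ⟨v, h⟩)
      obtain ⟨v, rfl⟩ := hS.ge (hsupp ⟨_, h.symm⟩)
      exact ⟨s(u, v), (hadj u v).mp h, rfl⟩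
    · rintro ⟨e, he, heq⟩
      rw [← heq]
      induction e with
      | _ a b => exact (hadj a b).mpr he

theorem rigidityRow_comm [DecidableEq V] (p : V → Fin 3 → ℝ) (x y : V) :
    rigidityRow p x y = rigidityRow p y x := by
  ext vi
  simp only [rigidityRow]
  ring

/-- The row of the rigidity matrix attached to an unordered pair. -/
def edgeRow [DecidableEq V] (p : V → Fin 3 → ℝ) : Sym2 V → V × Fin 3 → ℝ :=
  Sym2.lift ⟨rigidityRow p, rigidityRow_comm p⟩

theorem edgeRow_mk [DecidableEq V] (p : V → Fin 3 → ℝ) (x y : V) :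
    edgeRow p s(x, y) = rigidityRow p x y := rfl

theorem rigidityRank_eq [DecidableEq V] (G : SimpleGraph V) (p : V → Fin 3 → ℝ) :
    rigidityRank G p = (Set.range fun e : G.edgeSet => edgeRow p e).finrank ℝ := by
  have h : {w | ∃ x y, G.Adj x y ∧ w = rigidityRow p x y} =
      Set.range fun e : G.edgeSet => edgeRow p e := by
    ext w
    constructor
    · rintro ⟨x, y, h, rfl⟩
      exact ⟨⟨s(x, y), h⟩, rfl⟩
    · rintro ⟨⟨e, he⟩, rfl⟩
      induction e with
      | _ x y => exact ⟨x, y, he, rfl⟩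
  rw [rigidityRank, h, Set.finrank]

theorem rigidityRank_le [DecidableEq V] {G : SimpleGraph V} (hG : G.edgeSet.Finite)
    (p : V → Fin 3 → ℝ) : rigidityRank G p ≤ G.edgeSet.ncard := by
  have := hG.fintype
  rw [rigidityRank_eq, ← Nat.card_coe_set_eq, Nat.card_eq_fintype_card]
  exact finrank_range_le_card _

theorem genRank_le [DecidableEq V] {G : SimpleGraph V} (hG : G.edgeSet.Finite) :
    genRank G ≤ G.edgeSet.ncard :=
  csSup_le ⟨_, 0, rfl⟩ (by rintro _ ⟨p, rfl⟩; exact rigidityRank_le hG p)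

theorem IsIndependent.exists_linearIndepOn [DecidableEq V] {G : SimpleGraph V}
    (h : IsIndependent G) (hG : G.edgeSet.Finite) :
    ∃ p, LinearIndepOn ℝ (edgeRow p) G.edgeSet := by
  have hmem : genRank G ∈ {n : ℕ | ∃ p : V → Fin 3 → ℝ, n = rigidityRank G p} :=
    Nat.sSup_mem ⟨_, 0, rfl⟩
      ⟨G.edgeSet.ncard, by rintro _ ⟨p, rfl⟩; exact rigidityRank_le hG p⟩
  obtain ⟨p, hp⟩ := hmem
  have := hG.fintype
  refine ⟨p, linearIndependent_iff_card_eq_finrank_span.mpr ?_⟩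
  rw [← Nat.card_eq_fintype_card, Nat.card_coe_set_eq, ← h, hp, rigidityRank_eq]

/-- The number of edges of a subgraph of the union of two rings of seven butterflies that share
the vertices of a hinge is too small for the subgraph to be rigid. -/
theorem nucleationFree_union [DecidableEq V]
    {R R' : SimpleGraph V} {S S' : Set V} {f f' : ZMod 7 × Fin 3 → V}
    (hR : IsRingOfButterfliesOn 7 R S f) (hR' : IsRingOfButterfliesOn 7 R' S' f')
    {x y : V} (hinter : S ∩ S' = {x, y})
    (hhinge : ∃ i : ZMod 7, (f (i, 0) = x ∧ f (i, 1) = y) ∨ (f (i, 0) = y ∧ f (i, 1) = x))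
    (hhinge' : ∃ i : ZMod 7,
      (f' (i, 0) = x ∧ f' (i, 1) = y) ∨ (f' (i, 0) = y ∧ f' (i, 1) = x)) :
    NucleationFree (R ⊔ R') := by
  classical
  intro H hH hrigid
  have hXfin : H.verts.Finite := Set.finite_of_ncard_pos (by omega)
  let A : Finset (ZMod 7 × Fin 3) := Finset.univ.filter fun v => f v ∈ H.verts
  let A' : Finset (ZMod 7 × Fin 3) := Finset.univ.filter fun v => f' v ∈ H.verts
  let E := Finset.univ.filter fun e => ∀ v ∈ ringEdge e, v ∈ A
  let E' := Finset.univ.filter fun e => ∀ v ∈ ringEdge e, v ∈ A'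
  let T : Finset (Sym2 V) := E.image (fun e => (ringEdge e).map f) ∪
    E'.image (fun e => (ringEdge e).map f')
  have hT : T.card ≤ E.card + E'.card :=
    (Finset.card_union_le _ _).trans (add_le_add Finset.card_image_le Finset.card_image_le)
  have hmap : ∀ e ∈ H.coe.edgeSet, Sym2.map Subtype.val e ∈ (T : Set (Sym2 V)) := by
    intro e he
    have hV : ∀ v ∈ Sym2.map Subtype.val e, v ∈ H.verts := by
      intro v hv
      obtain ⟨w, -, rfl⟩ := Sym2.mem_map.mp hv
      exact w.2
    have hU : Sym2.map Subtype.val e ∈ R.edgeSet ∪ R'.edgeSet := by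
      rw [← SimpleGraph.edgeSet_sup]
      induction e with
      | _ a b => exact H.adj_sub he
    rw [hR.edgeSet_eq, hR'.edgeSet_eq] at hU
    rw [Finset.mem_coe, Finset.mem_union, Finset.mem_image, Finset.mem_image]
    refine hU.imp ?_ ?_ <;>
    · rintro ⟨i, hi⟩
      refine ⟨i, Finset.mem_filter.mpr ⟨Finset.mem_univ _, fun v hv => ?_⟩, hi⟩
      refine Finset.mem_filter.mpr ⟨Finset.mem_univ _, hV _ ?_⟩
      rw [← hi]
      exact Sym2.mem_map.mpr ⟨v, hv, rfl⟩
  have hinj : Function.Injective (Sym2.map (Subtype.val : H.verts → V)) :=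
    Sym2.map.injective Subtype.val_injective
  have hEfin : H.coe.edgeSet.Finite :=
    Set.Finite.of_finite_image (T.finite_toSet.subset (Set.image_subset_iff.mpr hmap))
      hinj.injOn
  have hedges : H.coe.edgeSet.ncard ≤ T.card := by
    rw [← Set.ncard_coe_finset]
    exact Set.ncard_le_ncard_of_injOn _ hmap hinj.injOn T.finite_toSet
  have hrank : 3 * H.verts.ncard - 6 ≤ E.card + E'.card := by
    have h1 : genRank H.coe = 3 * Nat.card H.verts - 6 := hrigid
    rw [Nat.card_coe_set_eq] at h1
    exact h1 ▸ (genRank_le hEfin).trans (hedges.trans hT)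
  let B := A.image f
  let B' := A'.image f'
  have hB : B.card = A.card := Finset.card_image_of_injective _ hR.1
  have hB' : B'.card = A'.card := Finset.card_image_of_injective _ hR'.1
  have hBB : (B ∪ B').card ≤ H.verts.ncard := by
    rw [← Set.ncard_coe_finset]
    refine Set.ncard_le_ncard ?_ hXfin
    intro v hv
    rcases Finset.mem_union.mp (Finset.mem_coe.mp hv) with h | h <;>
    · obtain ⟨w, hw, rfl⟩ := Finset.mem_image.mp h
      exact (Finset.mem_filter.mp hw).2
  have hsub : B ∩ B' ⊆ {x, y} := by
    intro v hv
    obtain ⟨h1, h2⟩ := Finset.mem_inter.mp hv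
    obtain ⟨w, -, rfl⟩ := Finset.mem_image.mp h1
    obtain ⟨w', -, hw'⟩ := Finset.mem_image.mp h2
    have : f w ∈ S ∩ S' := ⟨hR.2.1 ▸ ⟨w, rfl⟩, hR'.2.1 ▸ ⟨w', hw'⟩⟩
    rw [hinter] at this
    simpa using this
  have hle : (B ∩ B').card ≤ 2 := (Finset.card_le_card hsub).trans Finset.card_le_two
  have hflags : (B ∩ B').card = 2 →
      (∃ i, (i, 0) ∈ A ∧ (i, 1) ∈ A) ∧ (∃ i, (i, 0) ∈ A' ∧ (i, 1) ∈ A') := by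
    intro h2
    have heq : B ∩ B' = {x, y} :=
      Finset.eq_of_subset_of_card_le hsub (by rw [h2]; exact Finset.card_le_two)
    have hX : ∀ v ∈ B ∩ B', v ∈ H.verts := by
      intro v hv
      obtain ⟨w, hw, rfl⟩ := Finset.mem_image.mp (Finset.mem_inter.mp hv).1
      exact (Finset.mem_filter.mp hw).2
    have hx : x ∈ H.verts := hX x (by simp [heq])
    have hy : y ∈ H.verts := hX y (by simp [heq])
    constructor
    · obtain ⟨i, ⟨h0, h1⟩ | ⟨h0, h1⟩⟩ := hhinge <;> exact ⟨i, by simp [A, h0, h1, hx, hy]⟩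
    · obtain ⟨i, ⟨h0, h1⟩ | ⟨h0, h1⟩⟩ := hhinge' <;> exact ⟨i, by simp [A', h0, h1, hx, hy]⟩
  have hcard := Finset.card_union_add_card_inter B B'
  have hi1 : (B ∩ B').card ≤ B.card := Finset.card_le_card Finset.inter_subset_left
  have hi2 : (B ∩ B').card ≤ B'.card := Finset.card_le_card Finset.inter_subset_right
  have hs : SparseBound A.card (3 * A.card - E.card) _ := sparseBound_ring A
  have hs' : SparseBound A'.card (3 * A'.card - E'.card) _ := sparseBound_ring A'
  obtain ⟨-, a0, a1, a2, a3, a4, a5⟩ := hs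
  obtain ⟨-, b0, b1, b2, b3, b4, b5⟩ := hs'
  by_cases h2 : (B ∩ B').card = 2
  · obtain ⟨-, a6, a7⟩ := a5 (hflags h2).1
    obtain ⟨-, b6, b7⟩ := b5 (hflags h2).2
    omega
  · clear a5 b5
    omega

theorem rigidityRow_self [DecidableEq V] (p : V → Fin 3 → ℝ) (x : V) :
    rigidityRow p x x = 0 := by
  ext vi
  simp [rigidityRow]

theorem rigidityRow_ne_zero [DecidableEq V] {p : V → Fin 3 → ℝ} {x y : V} (h : p x ≠ p y) :
    rigidityRow p x y ≠ 0 := by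
  intro h0
  have hxy : x ≠ y := fun e => h (e ▸ rfl)
  refine h (funext fun k => ?_)
  have := congrFun h0 (x, k)
  simp only [rigidityRow, if_true, if_neg hxy, Pi.zero_apply] at this
  linarith

/-- Any four vectors of `ℝ³` satisfy a nontrivial linear relation. -/
theorem exists_relation_of_four (w : Fin 4 → Fin 3 → ℝ) :
    ∃ μ : Fin 4 → ℝ, μ ≠ 0 ∧ ∀ k, ∑ j, μ j * w j k = 0 := by
  obtain ⟨μ, hμ, hne⟩ := (Submodule.ne_bot_iff _).mp
    (LinearMap.ker_ne_bot_of_finrank_lt (f := Matrix.vecMulLinear (Matrix.of w)) (by simp))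
  exact ⟨μ, hne, fun k => congrFun hμ k⟩

/-- Any five points of `ℝ³` satisfy a nontrivial affine relation. -/
theorem exists_affine_relation_of_five (q : Fin 5 → Fin 3 → ℝ) :
    ∃ c : Fin 5 → ℝ, c ≠ 0 ∧ ∑ j, c j = 0 ∧ ∀ k, ∑ j, c j * q j k = 0 := by
  let M : Matrix (Fin 5) (Fin 4) ℝ := Matrix.of fun j => Fin.cons 1 (q j)
  obtain ⟨c, hc, hne⟩ := (Submodule.ne_bot_iff _).mp
    (LinearMap.ker_ne_bot_of_finrank_lt (f := Matrix.vecMulLinear M) (by simp))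
  have h : ∀ k, ∑ j, c j * M j k = 0 := fun k => congrFun hc k
  exact ⟨c, hne, by simpa [M] using h 0, fun k => by simpa [M] using h k.succ⟩

/-- An affine relation `c` between points of a framework yields the self-stress `c i * c j` of the
complete graph on these points. -/
theorem sum_mul_rigidityRow_eq_zero [DecidableEq V] (p : V → Fin 3 → ℝ) {n : ℕ} (v : Fin n → V)
    (c : Fin n → ℝ) (h0 : ∑ j, c j = 0) (h1 : ∀ k, ∑ j, c j * p (v j) k = 0) :
    ∑ i, ∑ j, (c i * c j) • rigidityRow p (v i) (v j) = 0 := by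
  have half : ∀ (z : V) (k : Fin 3), ∑ i, ∑ j, (c i * c j) *
      (if z = v i then p (v i) k - p (v j) k else 0) = 0 := by
    intro z k
    refine Finset.sum_eq_zero fun i _ => ?_
    by_cases h : z = v i
    · simp only [if_pos h]
      calc ∑ j, (c i * c j) * (p (v i) k - p (v j) k)
          = c i * p (v i) k * ∑ j, c j - c i * ∑ j, c j * p (v j) k := by
            rw [Finset.mul_sum, Finset.mul_sum, ← Finset.sum_sub_distrib]
            exact Finset.sum_congr rfl fun j _ => by ring
        _ = 0 := by rw [h0, h1]; ring
    · simp [if_neg h]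
  ext ⟨z, k⟩
  simp only [Finset.sum_apply, Pi.smul_apply, smul_eq_mul, rigidityRow, mul_add,
    Finset.sum_add_distrib, Pi.zero_apply]
  rw [half, zero_add, Finset.sum_comm]
  simpa only [mul_comm (c _) (c _)] using half z k

section Ring

variable [DecidableEq V] {p : V → Fin 3 → ℝ} {f : ZMod 7 × Fin 3 → V}

/-- In a framework with independent rows, the two vertices of a hinge are placed at distinct
points. -/
theorem hinge_ne (hp : LinearIndependent ℝ fun e => edgeRow p ((ringEdge e).map f))
    (i : ZMod 7) : p (f (i, 0)) ≠ p (f (i, 1)) := by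
  intro heq
  let n : Fin 4 → V := ![f (i, 2), f (i + 1, 0), f (i + 1, 1), f (i - 1, 2)]
  obtain ⟨μ, hμ, hrel⟩ := exists_relation_of_four fun j => p (f (i, 0)) - p (n j)
  let idx : Fin 4 ⊕ Fin 4 → ZMod 7 × Fin 8 :=
    Sum.elim ![(i, 0), (i, 4), (i, 5), (i - 1, 2)] ![(i, 1), (i, 6), (i, 7), (i - 1, 3)]
  have hidx : Function.Injective idx := by
    have : ∀ i : ZMod 7, Function.Injective (Sum.elim
      ![(i, (0 : Fin 8)), (i, 4), (i, 5), (i - 1, 2)] ![(i, 1), (i, 6), (i, 7), (i - 1, 3)]) := by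
      unfold Function.Injective
      decide +kernel
    exact this i
  have hli := Fintype.linearIndependent_iff.mp (hp.comp idx hidx) (Sum.elim μ (-μ)) (by
    have h0 : ∀ j, edgeRow p ((ringEdge (idx (Sum.inl j))).map f) =
        rigidityRow p (f (i, 0)) (n j) := by
      intro j
      fin_cases j
      · rfl
      · rfl
      · rfl
      · simp [idx, ringEdge, linkVertex, butterflyEdge, edgeRow_mk, n,
          rigidityRow_comm p (f (i, 0))]
    have h1 : ∀ j, edgeRow p ((ringEdge (idx (Sum.inr j))).map f) =
        rigidityRow p (f (i, 1)) (n j) := by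
      intro j
      fin_cases j
      · rfl
      · rfl
      · rfl
      · simp [idx, ringEdge, linkVertex, butterflyEdge, edgeRow_mk, n,
          rigidityRow_comm p (f (i, 1))]
    rw [Fintype.sum_sum_type]
    simp only [Function.comp_apply, h0, h1, Sum.elim_inl, Sum.elim_inr, Pi.neg_apply, neg_smul,
      Finset.sum_neg_distrib, ← sub_eq_add_neg, ← Finset.sum_sub_distrib, ← smul_sub]
    ext ⟨z, k⟩
    have hr := hrel k
    simp only [Finset.sum_apply, Pi.smul_apply, Pi.sub_apply, smul_eq_mul, rigidityRow, ← heq,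
      Pi.zero_apply, add_sub_add_comm, sub_self, add_zero] at hr ⊢
    refine Eq.trans ?_ (mul_eq_zero_of_right
      ((if z = f (i, 0) then 1 else 0) - (if z = f (i, 1) then 1 else 0)) hr)
    rw [Finset.mul_sum]
    refine Finset.sum_congr rfl fun j _ => ?_
    split_ifs <;> ring)
  exact hμ (funext fun j => hli (Sum.inl j))

/-- The coefficients on the edges of a butterfly of a self-stress of product type. -/
def butterflyStress (c : Fin 5 → ℝ) (k : Fin 8) : ℝ :=
  c (butterflyEdge k).1 * c (butterflyEdge k).2

/-- Each link carries a relation between the rows of its edges and of its two hinges. -/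
theorem exists_link_relation (p : V → Fin 3 → ℝ) (f : ZMod 7 × Fin 3 → V) (i : ZMod 7) :
    ∃ c : Fin 5 → ℝ, c ≠ 0 ∧ ∑ j, c j = 0 ∧ (∀ k, ∑ j, c j * p (f (linkVertex i j)) k = 0) ∧
      (c 0 * c 1) • rigidityRow p (f (i, 0)) (f (i, 1)) +
        (c 3 * c 4) • rigidityRow p (f (i + 1, 0)) (f (i + 1, 1)) +
        ∑ k, butterflyStress c k • edgeRow p ((ringEdge (i, k)).map f) = 0 := by
  obtain ⟨c, hne, h0, h1⟩ := exists_affine_relation_of_five fun j => p (f (linkVertex i j))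
  refine ⟨c, hne, h0, h1, ?_⟩
  have H := sum_mul_rigidityRow_eq_zero p (fun j => f (linkVertex i j)) c h0 h1
  have key : ∑ a, ∑ b, (c a * c b) • rigidityRow p (f (linkVertex i a)) (f (linkVertex i b)) =
      (2 : ℝ) • ((c 0 * c 1) • rigidityRow p (f (i, 0)) (f (i, 1)) +
        (c 3 * c 4) • rigidityRow p (f (i + 1, 0)) (f (i + 1, 1)) +
        ∑ k, butterflyStress c k • edgeRow p ((ringEdge (i, k)).map f)) := by
    ext ⟨z, k⟩
    simp [Fin.sum_univ_succ, linkVertex, butterflyStress, butterflyEdge, ringEdge, edgeRow_mk,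
      rigidityRow_self]
    rw [rigidityRow_comm p (f (i, 1)) (f (i, 0)), rigidityRow_comm p (f (i, 2)) (f (i, 0)),
      rigidityRow_comm p (f (i, 2)) (f (i, 1)), rigidityRow_comm p (f (i + 1, 0)) (f (i, 0)),
      rigidityRow_comm p (f (i + 1, 0)) (f (i, 1)), rigidityRow_comm p (f (i + 1, 0)) (f (i, 2)),
      rigidityRow_comm p (f (i + 1, 1)) (f (i, 0)), rigidityRow_comm p (f (i + 1, 1)) (f (i, 1)),
      rigidityRow_comm p (f (i + 1, 1)) (f (i, 2)),
      rigidityRow_comm p (f (i + 1, 1)) (f (i + 1, 0))]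
    ring
  rw [H] at key
  exact (smul_eq_zero.mp key.symm).resolve_left two_ne_zero

/-- An affine relation between the vertices of a link whose self-stress vanishes on the butterfly
is trivial, unless the vertices of a hinge are placed at the same point. -/
theorem eq_zero_of_butterflyStress_eq_zero {q : Fin 5 → Fin 3 → ℝ} (h01 : q 0 ≠ q 1)
    (h34 : q 3 ≠ q 4) {c : Fin 5 → ℝ} (h0 : ∑ j, c j = 0)
    (h1 : ∀ k, ∑ j, c j * q j k = 0) (hs : ∀ k, butterflyStress c k = 0) : c = 0 := by
  have s0 : c 0 * c 2 = 0 := hs 0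
  have s1 : c 1 * c 2 = 0 := hs 1
  have s2 : c 2 * c 3 = 0 := hs 2
  have s3 : c 2 * c 4 = 0 := hs 3
  have s4 : c 0 * c 3 = 0 := hs 4
  have s5 : c 0 * c 4 = 0 := hs 5
  have s6 : c 1 * c 3 = 0 := hs 6
  have s7 : c 1 * c 4 = 0 := hs 7
  obtain ⟨k, hk⟩ := Function.ne_iff.mp h01
  obtain ⟨l, hl⟩ := Function.ne_iff.mp h34
  have hk1 := h1 k
  have hl1 := h1 l
  simp only [Fin.sum_univ_five] at h0 hk1 hl1
  have c2 : c 2 = 0 := by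
    refine pow_eq_zero_iff two_ne_zero |>.mp ?_
    linear_combination c 2 * h0 - s0 - s1 - s2 - s3
  have hprod : c 0 * (c 0 + c 1) = 0 := by linear_combination c 0 * h0 - s0 - s4 - s5
  have hprod' : c 3 * (c 3 + c 4) = 0 := by linear_combination c 3 * h0 - s2 - s4 - s6
  have c0 : c 0 = 0 := by
    refine pow_eq_zero_iff two_ne_zero |>.mp
      ((mul_eq_zero.mp ?_).resolve_right (sub_ne_zero.mpr hk))
    linear_combination c 0 * hk1 - q 1 k * hprod - q 2 k * s0 - q 3 k * s4 - q 4 k * s5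
  have c3 : c 3 = 0 := by
    refine pow_eq_zero_iff two_ne_zero |>.mp
      ((mul_eq_zero.mp ?_).resolve_right (sub_ne_zero.mpr hl))
    linear_combination c 3 * hl1 - q 4 l * hprod' - q 2 l * s2 - q 0 l * s4 - q 1 l * s6
  have c1 : c 1 = 0 := by
    refine pow_eq_zero_iff two_ne_zero |>.mp ?_
    linear_combination c 1 * h0 - s1 - s6 - s7 - c 1 * c0
  have c4 : c 4 = 0 := by
    linear_combination h0 - c0 - c1 - c2 - c3
  ext j
  fin_cases j <;> assumption

/-- In a framework with independent rows, the row of a hinge of a ring of seven butterflies is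
spanned by the rows of the edges of the ring. -/
theorem hinge_mem_span (hp : LinearIndependent ℝ fun e => edgeRow p ((ringEdge e).map f))
    (i₀ : ZMod 7) : rigidityRow p (f (i₀, 0)) (f (i₀, 1)) ∈
      Submodule.span ℝ (Set.range fun e => edgeRow p ((ringEdge e).map f)) := by
  choose c hne hsum hrel hrow using exists_link_relation p f
  let h : ZMod 7 → V × Fin 3 → ℝ := fun i => rigidityRow p (f (i, 0)) (f (i, 1))
  let α : (ZMod 7 → ℝ) →ₗ[ℝ] (ZMod 7 → ℝ) :=
    { toFun := fun t i => t i * (c i 0 * c i 1) + t (i - 1) * (c (i - 1) 3 * c (i - 1) 4)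
      map_add' := fun s t => by ext i; simp only [Pi.add_apply]; ring
      map_smul' := fun r t => by
        ext i
        simp only [Pi.smul_apply, smul_eq_mul, RingHom.id_apply]
        ring }
  obtain ⟨t, ht, htne⟩ := (Submodule.ne_bot_iff _).mp
    (LinearMap.ker_ne_bot_of_finrank_lt
      (f := (LinearMap.funLeft ℝ ℝ (Subtype.val : {i : ZMod 7 // i ≠ i₀} → ZMod 7)) ∘ₗ α)
      (by simp [Fintype.card_subtype_compl]))
  have hα : ∀ i ≠ i₀, α t i = 0 := fun i hi => congrFun ht ⟨i, hi⟩
  let g : ZMod 7 × Fin 8 → ℝ := fun e => t e.1 * butterflyStress (c e.1) e.2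
  have total : α t i₀ • h i₀ + ∑ e, g e • edgeRow p ((ringEdge e).map f) = 0 := by
    have h1 : ∑ i, t i • ((c i 0 * c i 1) • h i + (c i 3 * c i 4) • h (i + 1) +
        ∑ k, butterflyStress (c i) k • edgeRow p ((ringEdge (i, k)).map f)) = 0 :=
      Finset.sum_eq_zero fun i _ => by rw [hrow i, smul_zero]
    have h2 : ∑ i, (t i * (c i 3 * c i 4)) • h (i + 1) =
        ∑ i, (t (i - 1) * (c (i - 1) 3 * c (i - 1) 4)) • h i := by
      simpa using Equiv.sum_comp (Equiv.addRight (1 : ZMod 7))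
        fun i => (t (i - 1) * (c (i - 1) 3 * c (i - 1) 4)) • h i
    have h3 : ∑ i, α t i • h i = α t i₀ • h i₀ :=
      Fintype.sum_eq_single i₀ fun i hi => by rw [hα i hi, zero_smul]
    rw [← h3, Fintype.sum_prod_type, ← h1]
    simp only [smul_add, Finset.sum_add_distrib, smul_smul, Finset.smul_sum]
    rw [h2]
    simp only [α, g, LinearMap.coe_mk, AddHom.coe_mk, add_smul, Finset.sum_add_distrib]
  have hmem : ∑ e, g e • edgeRow p ((ringEdge e).map f) ∈
      Submodule.span ℝ (Set.range fun e => edgeRow p ((ringEdge e).map f)) :=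
    Submodule.sum_mem _ fun e _ => Submodule.smul_mem _ _ (Submodule.subset_span ⟨e, rfl⟩)
  by_cases h0 : α t i₀ = 0
  · exfalso
    rw [h0, zero_smul, zero_add] at total
    have hg := Fintype.linearIndependent_iff.mp hp g total
    refine htne (funext fun i => ?_)
    by_contra hti
    exact hne i (eq_zero_of_butterflyStress_eq_zero (hinge_ne hp i) (hinge_ne hp (i + 1))
      (hsum i) (hrel i) fun k => (mul_eq_zero.mp (hg (i, k))).resolve_left hti)
  · rw [← Submodule.smul_mem_iff _ h0]
    exact eq_neg_of_add_eq_zero_left total ▸ Submodule.neg_mem _ hmem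

end Ring

theorem IsRingOfButterfliesOn.hinge_mem_span [DecidableEq V] {R : SimpleGraph V} {S : Set V}
    {f : ZMod 7 × Fin 3 → V} (hR : IsRingOfButterfliesOn 7 R S f) {p : V → Fin 3 → ℝ}
    (hp : LinearIndepOn ℝ (edgeRow p) R.edgeSet) {x y : V}
    (hhinge : ∃ i : ZMod 7, (f (i, 0) = x ∧ f (i, 1) = y) ∨ (f (i, 0) = y ∧ f (i, 1) = x)) :
    rigidityRow p x y ≠ 0 ∧ rigidityRow p x y ∈ Submodule.span ℝ (edgeRow p '' R.edgeSet) := by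
  have hE := hR.edgeSet_eq
  have hli : LinearIndependent ℝ fun e => edgeRow p ((ringEdge e).map f) :=
    hp.comp (fun e => ⟨(ringEdge e).map f, hE.ge ⟨e, rfl⟩⟩) fun a b hab =>
      ringEdge_injective (Sym2.map.injective hR.1 (congrArg Subtype.val hab))
  have hspan : edgeRow p '' R.edgeSet = Set.range fun e => edgeRow p ((ringEdge e).map f) := by
    rw [hE, ← Set.range_comp]
    rfl
  rw [hspan]
  obtain ⟨i, ⟨rfl, rfl⟩ | ⟨rfl, rfl⟩⟩ := hhinge
  · exact ⟨rigidityRow_ne_zero (hinge_ne hli i), Rigidity.hinge_mem_span hli i⟩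
  · rw [rigidityRow_comm]
    exact ⟨rigidityRow_ne_zero (hinge_ne hli i), Rigidity.hinge_mem_span hli i⟩

/-- Let `R` and `R'` be two rings of butterflies, each with 7 links,
that are edge-disjoint and share exactly the two endpoints of a common hinge `{x, y}`.
Then `R ∪ R'` is dependent and nucleation-free. -/
theorem two_rings_union_dependent_nucleationFree {V : Type*} [DecidableEq V]
    (R R' : SimpleGraph V) (S S' : Set V)
    (f f' : ZMod 7 × Fin 3 → V)
    (hR : IsRingOfButterfliesOn 7 R S f) (hR' : IsRingOfButterfliesOn 7 R' S' f')
    (x y : V) (hxy : x ≠ y)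
    (hinter : S ∩ S' = {x, y})
    (hhinge : ∃ i : ZMod 7, (f (i, 0) = x ∧ f (i, 1) = y) ∨ (f (i, 0) = y ∧ f (i, 1) = x))
    (hhinge' : ∃ i : ZMod 7,
      (f' (i, 0) = x ∧ f' (i, 1) = y) ∨ (f' (i, 0) = y ∧ f' (i, 1) = x))
    (hedisj : R.edgeSet ∩ R'.edgeSet = ∅) :
    ¬ IsIndependent (R ⊔ R') ∧ NucleationFree (R ⊔ R') := by
  refine ⟨fun hind => ?_, nucleationFree_union hR hR' hinter hhinge hhinge'⟩
  have hfin : (R ⊔ R').edgeSet.Finite := by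
    rw [SimpleGraph.edgeSet_sup, hR.edgeSet_eq, hR'.edgeSet_eq]
    exact (Set.finite_range _).union (Set.finite_range _)
  obtain ⟨p, hp⟩ := hind.exists_linearIndepOn hfin
  rw [SimpleGraph.edgeSet_sup,
    linearIndepOn_union_iff (Set.disjoint_iff_inter_eq_empty.mpr hedisj)] at hp
  obtain ⟨h1, h2, hdisj⟩ := hp
  obtain ⟨hne, hmem⟩ := hR.hinge_mem_span h1 hhinge
  exact hne (Submodule.disjoint_def.mp hdisj _ hmem (hR'.hinge_mem_span h2 hhinge').2)

end Rigidity
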